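/- Let a : ℕ → ℝ be nonnegative and summable with effective dimension N(τ) := ∑'_j a_j/(a_j+τ), let σ > 0, q ∈ (0,1), M ≥ 2 an integer, τ_max > 0, Δ_q := { q^j·τ_max : j = 0, …, M−1 }, τ_min := q^{M−1}·τ_max. Let φ be a nonnegative nondecreasing function and J(τ) := √(log M)·σ²·√(N(τ))/τ + (log M)·σ²/τ + φ²(τ). If √(log M)·σ²·√(N(τ_min))/τ_min ≥ 1 and φ(τ_min) ≤ 1, then min_{τ ∈ Δ_q} J(τ) ≤ 2·q^{−3/2} · inf_{0 < τ ≤ τ_max} J(τ). (Thus the geometric grid Δ_q captures, up to a constant factor, the best separation radius over all regularization parameters in (0, τ_max].) -/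

import Mathlib

/-- The terms of the effective dimension are summable. -/
theorem summable_div_add {a : ℕ → ℝ} (ha : ∀ j, 0 ≤ a j) (hsum : Summable a) {τ : ℝ}
    (hτ : 0 < τ) : Summable fun j => a j / (a j + τ) := by
  refine Summable.of_nonneg_of_le (fun j => ?_) (fun j => ?_) (hsum.div_const τ)
  · have := ha j
    positivity
  · have := ha j
    gcongr
    linarith

/-- Moving the regularization parameter down by at most a factor `q ≤ 1` multiplies the effective
dimension by at most `q⁻¹`; for `q = 1` this is antitonicity. -/
theorem tsum_div_add_le {a : ℕ → ℝ} (ha : ∀ j, 0 ≤ a j) (hsum : Summable a) {q τ g : ℝ}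
    (hq0 : 0 < q) (hq1 : q ≤ 1) (hτ : 0 < τ) (hg : q * τ ≤ g) :
    ∑' j, a j / (a j + g) ≤ q⁻¹ * ∑' j, a j / (a j + τ) := by
  have hg0 : 0 < g := (mul_pos hq0 hτ).trans_le hg
  rw [← tsum_mul_left]
  refine (summable_div_add ha hsum hg0).tsum_le_tsum (fun j => ?_)
    ((summable_div_add ha hsum hτ).mul_left _)
  have haj := ha j
  rw [inv_mul_eq_div, div_div]
  rcases haj.eq_or_lt with h | h
  · simp [← h]
  · gcongr
    nlinarith

theorem rpow_neg_three_halves {q : ℝ} (hq : 0 < q) :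
    q ^ (-(3 : ℝ) / 2) = √(q⁻¹) * q⁻¹ := by
  rw [Real.sqrt_eq_rpow, Real.inv_rpow hq.le, ← Real.rpow_neg hq.le, ← Real.rpow_neg_one,
    ← Real.rpow_add hq]
  norm_num

/-- The stochastic part of the objective grows by at most `q ^ (-3/2)` when the regularization
parameter is moved down by at most a factor `q`. -/
theorem stochastic_terms_le {a : ℕ → ℝ} (ha : ∀ j, 0 ≤ a j) (hsum : Summable a)
    {q τ g A B : ℝ} (hA : 0 ≤ A) (hB : 0 ≤ B)
    (hq0 : 0 < q) (hq1 : q ≤ 1) (hτ : 0 < τ) (hg : q * τ ≤ g) :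
    A * √(∑' j, a j / (a j + g)) / g + B / g ≤
      q ^ (-(3 : ℝ) / 2) * (A * √(∑' j, a j / (a j + τ)) / τ + B / τ) := by
  have hqτ : 0 < q * τ := mul_pos hq0 hτ
  have hs : 1 ≤ √(q⁻¹) := Real.one_le_sqrt.2 ((one_le_inv₀ hq0).2 hq1)
  have hN : √(∑' j, a j / (a j + g)) ≤ √(q⁻¹) * √(∑' j, a j / (a j + τ)) := by
    rw [← Real.sqrt_mul (inv_nonneg.2 hq0.le)]
    exact Real.sqrt_le_sqrt (tsum_div_add_le ha hsum hq0 hq1 hτ hg)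
  calc A * √(∑' j, a j / (a j + g)) / g + B / g
      ≤ A * (√(q⁻¹) * √(∑' j, a j / (a j + τ))) / (q * τ) + √(q⁻¹) * B / (q * τ) := by
        gcongr
        exact le_mul_of_one_le_left hB hs
    _ = _ := by
        rw [rpow_neg_three_halves hq0]
        field_simp

/-- The geometric grid `Δ_q` captures, up to a constant, the best separation
radius over all parameters in `(0, τ_max]`: under the minimal-smoothness
conditions `√(log M) σ² √(N(τ_min))/τ_min ≥ 1` and `φ(τ_min) ≤ 1`,
`min_{τ ∈ Δ_q} J(τ) ≤ 2 q^{−3/2} inf_{0 < τ ≤ τ_max} J(τ)`. -/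
theorem stmt_16
    (a : ℕ → ℝ) (ha : ∀ j, 0 ≤ a j) (hsum : Summable a)
    (N : ℝ → ℝ) (hN : ∀ τ, N τ = ∑' j, a j / (a j + τ))
    (σ q : ℝ) (hσ : 0 < σ) (hq : q ∈ Set.Ioo (0 : ℝ) 1)
    (M : ℕ) (hM : 2 ≤ M)
    (τmax τmin : ℝ) (hτmax : 0 < τmax) (hτmin : τmin = q ^ (M - 1) * τmax)
    (φ : ℝ → ℝ) (hφ0 : ∀ t, 0 ≤ φ t) (hφmono : Monotone φ)
    (J : ℝ → ℝ)
    (hJ : ∀ τ, J τ = Real.sqrt (Real.log M) * σ ^ 2 * Real.sqrt (N τ) / τ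
      + Real.log M * σ ^ 2 / τ + φ τ ^ 2)
    (hstoch : 1 ≤ Real.sqrt (Real.log M) * σ ^ 2 * Real.sqrt (N τmin) / τmin)
    (hsmooth : φ τmin ≤ 1) :
    (⨅ j : Fin M, J (q ^ (j : ℕ) * τmax)) ≤
      2 * q ^ (-(3 : ℝ) / 2) * ⨅ τ : Set.Ioc (0 : ℝ) τmax, J τ := by
  obtain ⟨hq0, hq1⟩ := hq
  have hL : 0 ≤ Real.log M := Real.log_natCast_nonneg M
  have hA : 0 ≤ √(Real.log M) * σ ^ 2 := by positivity
  have hB : 0 ≤ Real.log M * σ ^ 2 := by positivity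
  have hτmin0 : 0 < τmin := hτmin ▸ by positivity
  have hC : 1 ≤ q ^ (-(3 : ℝ) / 2) :=
    Real.one_le_rpow_of_pos_of_le_one_of_nonpos hq0 hq1.le (by norm_num)
  have hJ0 : ∀ τ, 0 < τ → 0 ≤ J τ := fun τ hτ => by
    rw [hJ]
    positivity
  have hgrid : ∀ j < M, (⨅ j : Fin M, J (q ^ (j : ℕ) * τmax)) ≤ J (q ^ j * τmax) :=
    fun j hj => ciInf_le (f := fun j : Fin M => J (q ^ (j : ℕ) * τmax))
      (Set.finite_range _).bddBelow ⟨j, hj⟩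
  have : Nonempty (Set.Ioc (0 : ℝ) τmax) := ⟨⟨τmax, hτmax, le_rfl⟩⟩
  rw [Real.mul_iInf_of_nonneg (by positivity)]
  refine le_ciInf ?_
  rintro ⟨τ, hτ0, hτ1⟩
  have hJτ := hJ0 τ hτ0
  rcases le_or_gt τ τmin with hle | hlt
  · have hmin : (⨅ j : Fin M, J (q ^ (j : ℕ) * τmax)) ≤ J τmin :=
      hτmin ▸ hgrid (M - 1) (by omega)
    have hst := stochastic_terms_le ha hsum hA hB one_pos le_rfl hτ0
      ((one_mul τ).trans_le hle)
    rw [Real.one_rpow, one_mul, ← hN, ← hN] at hst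
    have hφ1 : φ τmin ^ 2 ≤ 1 := pow_le_one₀ (hφ0 _) hsmooth
    have hV : 0 ≤ Real.log M * σ ^ 2 / τmin := by positivity
    have h2 : J τmin ≤ 2 * J τ := by
      rw [hJ τmin, hJ τ]
      linarith [sq_nonneg (φ τ)]
    exact (hmin.trans h2).trans (mul_le_mul_of_nonneg_right (by linarith) hJτ)
  · obtain ⟨n, hn1, hn2⟩ := exists_nat_pow_near_of_lt_one (div_pos hτ0 hτmax)
      ((div_le_one hτmax).2 hτ1) hq0 hq1
    rw [lt_div_iff₀ hτmax] at hn1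
    rw [div_le_iff₀ hτmax] at hn2
    have hnM : n < M - 1 := by
      refine (pow_lt_pow_iff_right_of_lt_one₀ hq0 hq1).1 (lt_of_mul_lt_mul_right ?_ hτmax.le)
      exact hτmin ▸ hlt.trans_le hn2
    have hst := stochastic_terms_le (g := q ^ (n + 1) * τmax) ha hsum hA hB hq0 hq1.le hτ0 (by
      rw [pow_succ', mul_assoc]
      gcongr)
    rw [← hN, ← hN] at hst
    have hφ : φ (q ^ (n + 1) * τmax) ^ 2 ≤ φ τ ^ 2 :=
      pow_le_pow_left₀ (hφ0 _) (hφmono hn1.le) 2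
    have h1 : J (q ^ (n + 1) * τmax) ≤ q ^ (-(3 : ℝ) / 2) * J τ := by
      rw [hJ (q ^ (n + 1) * τmax), hJ τ]
      nlinarith [sq_nonneg (φ τ)]
    exact ((hgrid (n + 1) (by omega)).trans h1).trans
      (mul_le_mul_of_nonneg_right (by linarith) hJτ)
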